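/- arXiv:1712.09661 — 2 statements merged into one kernel-verified Lean document; each statement's English description precedes it below -/
import Mathlib

section
/- Let h : ℝ → ℝ be continuously differentiable on [0,1] with h(0) = 0. Then the infimum, over all functions f : ℝ → ℝ that are continuously differentiable on [0,1] with f(0) = 0 and f'(t) ≤ 0 for all t ∈ [0,1], of the total-variation distance ∫₀¹ |h'(t) − f'(t)| dt, equals ∫₀¹ max(h'(t), 0) dt; moreover this infimum is attained at the function f₁(t) = −∫₀ᵗ max(−h'(s), 0) ds. -/
open MeasureTheory Set intervalIntegral

/-- The integral of a function continuous on `[a, b]` is differentiable within `[a, b]`. -/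
theorem ContinuousOn.hasDerivWithinAt_integral_Icc {g : ℝ → ℝ} {a b t : ℝ}
    (hg : ContinuousOn g (Icc a b)) (ht : t ∈ Icc a b) :
    HasDerivWithinAt (fun u => ∫ s in a..u, g s) (g t) (Icc a b) t := by
  have : Fact (t ∈ Icc a b) := ⟨ht⟩
  have hint : IntervalIntegrable g volume a t :=
    (hg.mono (Icc_subset_Icc_right ht.2)).intervalIntegrable_of_Icc ht.1
  exact integral_hasDerivWithinAt_right hint
    (hg.stronglyMeasurableAtFilter_nhdsWithin measurableSet_Icc t) (hg t ht)

theorem abs_sub_neg_max_neg_zero (x : ℝ) : |x - -max (-x) 0| = max x 0 := by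
  rcases le_total x 0 with hx | hx
  · simp [max_eq_left (neg_nonneg.2 hx), max_eq_right hx]
  · simp [max_eq_right (neg_nonpos.2 hx), max_eq_left hx, abs_of_nonneg hx]

theorem max_zero_le_abs_sub {x y : ℝ} (hy : y ≤ 0) : max x 0 ≤ |x - y| :=
  max_le (by linarith [le_abs_self (x - y)]) (abs_nonneg _)

/-- Theorem 1 of Davydov–Zitikis (2017): the infimum of the total-variation distance
`∫₀¹ |h' − f'|` over continuously differentiable non-increasing competitors `f` with
`f 0 = 0` equals `∫₀¹ (h')₊`, and it is attained at `f₁ t = −∫₀ᵗ (−h')₊`. -/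
theorem index_of_increase_infimum
    (h h' : ℝ → ℝ)
    (hderiv : ∀ t ∈ Icc (0:ℝ) 1, HasDerivWithinAt h (h' t) (Icc (0:ℝ) 1) t)
    (hcont : ContinuousOn h' (Icc (0:ℝ) 1))
    (h0 : h 0 = 0) :
    IsLeast
      {v : ℝ | ∃ f f' : ℝ → ℝ,
        (∀ t ∈ Icc (0:ℝ) 1, HasDerivWithinAt f (f' t) (Icc (0:ℝ) 1) t) ∧
        ContinuousOn f' (Icc (0:ℝ) 1) ∧
        f 0 = 0 ∧
        (∀ t ∈ Icc (0:ℝ) 1, f' t ≤ 0) ∧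
        v = ∫ t in (0:ℝ)..1, |h' t - f' t|}
      (∫ t in (0:ℝ)..1, max (h' t) 0) ∧
    (∃ f₁' : ℝ → ℝ,
      (∀ t ∈ Icc (0:ℝ) 1, f₁' t = -max (-h' t) 0) ∧
      (∀ t ∈ Icc (0:ℝ) 1,
        HasDerivWithinAt (fun u => -∫ s in (0:ℝ)..u, max (-h' s) 0) (f₁' t) (Icc (0:ℝ) 1) t) ∧
      (∫ t in (0:ℝ)..1, |h' t - f₁' t|) = ∫ t in (0:ℝ)..1, max (h' t) 0) := by
  have hneg : ContinuousOn (fun s => max (-h' s) 0) (Icc (0:ℝ) 1) :=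
    hcont.neg.sup continuousOn_const
  have hderiv₁ : ∀ t ∈ Icc (0:ℝ) 1,
      HasDerivWithinAt (fun u => -∫ s in (0:ℝ)..u, max (-h' s) 0) (-max (-h' t) 0)
        (Icc (0:ℝ) 1) t :=
    fun t ht => (hneg.hasDerivWithinAt_integral_Icc ht).neg
  have heq : (∫ t in (0:ℝ)..1, |h' t - -max (-h' t) 0|) = ∫ t in (0:ℝ)..1, max (h' t) 0 := by
    simp only [abs_sub_neg_max_neg_zero]
  refine ⟨⟨⟨_, fun t => -max (-h' t) 0, hderiv₁, hneg.neg, by simp, fun t _ => by simp,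
    heq.symm⟩, ?_⟩, fun t => -max (-h' t) 0, fun _ _ => rfl, hderiv₁, heq⟩
  rintro v ⟨f, f', -, hf', -, hf'_nonpos, rfl⟩
  refine integral_mono_on zero_le_one
    ((hcont.sup continuousOn_const).intervalIntegrable_of_Icc zero_le_one)
    ((hcont.sub hf').abs.intervalIntegrable_of_Icc zero_le_one)
    fun t ht => max_zero_le_abs_sub (hf'_nonpos t ht)
end

section
/- Let h : ℝ → ℝ be continuously differentiable on [0,1], and define f₁(t) = −∫₀ᵗ max(−h'(s), 0) ds for t ∈ [0,1]. Then f₁ is non-increasing on [0,1], f₁(0) = 0, f₁ is differentiable on [0,1] with f₁'(t) = −max(−h'(t), 0), and ∫₀¹ |h'(t) − f₁'(t)| dt = ∫₀¹ max(h'(t), 0) dt. -/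
open MeasureTheory Set intervalIntegral

theorem add_max_neg_zero (x : ℝ) : x + max (-x) 0 = max x 0 := by
  rw [← max_add_add_left, add_neg_cancel, add_zero, max_comm]

/-- Attainment part in the proof of Theorem 1: the function
`f₁ t = −∫₀ᵗ (−h'(s))₊ ds` is non-increasing on `[0,1]`, vanishes at `0`,
has derivative `−(−h')₊`, and realizes the distance `∫₀¹ (h')₊`. -/
theorem index_of_increase_attained
    (h h' : ℝ → ℝ)
    (hderiv : ∀ t ∈ Icc (0:ℝ) 1, HasDerivWithinAt h (h' t) (Icc (0:ℝ) 1) t)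
    (hcont : ContinuousOn h' (Icc (0:ℝ) 1))
    (f₁ : ℝ → ℝ)
    (hf₁ : ∀ t ∈ Icc (0:ℝ) 1, f₁ t = -∫ s in (0:ℝ)..t, max (-h' s) 0) :
    AntitoneOn f₁ (Icc (0:ℝ) 1) ∧
    f₁ 0 = 0 ∧
    (∀ t ∈ Icc (0:ℝ) 1, HasDerivWithinAt f₁ (-max (-h' t) 0) (Icc (0:ℝ) 1) t) ∧
    (∫ t in (0:ℝ)..1, |h' t - (-max (-h' t) 0)|) = ∫ t in (0:ℝ)..1, max (h' t) 0 := by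
  have hg : ContinuousOn (fun s => max (-h' s) 0) (Icc (0:ℝ) 1) := hcont.neg.sup continuousOn_const
  have hf₁deriv : ∀ t ∈ Icc (0:ℝ) 1,
      HasDerivWithinAt f₁ (-max (-h' t) 0) (Icc (0:ℝ) 1) t := fun t ht =>
    (hg.hasDerivWithinAt_integral_Icc ht).neg.congr hf₁ (hf₁ t ht)
  refine ⟨?_, ?_, hf₁deriv, ?_⟩
  · refine antitoneOn_of_hasDerivWithinAt_nonpos (convex_Icc 0 1)
      (fun t ht => (hf₁deriv t ht).continuousWithinAt)
      (fun t ht => (hf₁deriv t (interior_subset ht)).mono interior_subset)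
      (fun t _ => neg_nonpos.2 (le_max_right _ _))
  · simp [hf₁ 0 (left_mem_Icc.2 zero_le_one)]
  · simp only [sub_neg_eq_add, add_max_neg_zero, abs_of_nonneg (le_max_right _ (0:ℝ))]
end
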